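/- If the Products statement holds, then the Uniform statement holds. -/

import Mathlib

/-- A finite set `X` is transitive if its symmetry group acts transitively on it. -/
def IsTransitiveSet {m : ℕ} (X : Set (EuclideanSpace ℝ (Fin m))) : Prop :=
  ∀ x ∈ X, ∀ y ∈ X,
    ∃ g : EuclideanSpace ℝ (Fin m) ≃ᵢ EuclideanSpace ℝ (Fin m), g '' X = X ∧ g x = y

/-- `Y ⊆ ℝ^N` is `k`-Ramsey for `X ⊆ ℝ^m` if every `k`-colouring of `Y` admits a
monochromatic isometric copy of `X` inside `Y`. -/
def IsKRamseyFor {m N : ℕ} (k : ℕ) (Y : Set (EuclideanSpace ℝ (Fin N)))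
    (X : Set (EuclideanSpace ℝ (Fin m))) : Prop :=
  ∀ c : Y → Fin k,
    ∃ f : EuclideanSpace ℝ (Fin m) → EuclideanSpace ℝ (Fin N),
      (∀ x ∈ X, ∀ y ∈ X, dist (f x) (f y) = dist x y) ∧
      ∃ hf : ∀ x ∈ X, f x ∈ Y,
        ∃ col : Fin k, ∀ x (hx : x ∈ X), c ⟨f x, hf x hx⟩ = col

/-- The `n`-fold product `X^n ⊆ ℝ^{mn}` of a set `X ⊆ ℝ^m`, with coordinates
identified via `Fin m × Fin n ≃ Fin (m·n)`. -/
def productSet {m : ℕ} (X : Set (EuclideanSpace ℝ (Fin m))) (n : ℕ) :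
    Set (EuclideanSpace ℝ (Fin (m * n))) :=
  {p | ∃ x : Fin n → EuclideanSpace ℝ (Fin m), (∀ j, x j ∈ X) ∧
    ∀ i : Fin (m * n),
      p i = x (finProdFinEquiv.symm i).2 (finProdFinEquiv.symm i).1}

/-- Conjecture 2 of the paper (the Products statement). -/
def ProductsStatement : Prop :=
  ∀ (m : ℕ) (X : Set (EuclideanSpace ℝ (Fin m))), X.Finite → IsTransitiveSet X →
    ∀ k : ℕ, 1 ≤ k → ∃ (n : ℕ) (lam : ℝ), 0 < lam ∧
      IsKRamseyFor k ((fun p => lam • p) '' productSet X n) X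

/-- `π` is a rearrangement of the template `τ`: each symbol occurs in `π`
exactly as often as in `τ`. -/
def IsRearrangement {ℓ m : ℕ} (τ π : Fin ℓ → Fin m) : Prop :=
  ∀ j : Fin m,
    (Finset.univ.filter fun i => π i = j).card =
      (Finset.univ.filter fun i => τ i = j).card

/-- The word `a^π` determined by blocks `I_1, …, I_ℓ`, background letters `a`,
and a rearrangement `π`. -/
noncomputable def blockWord {ℓ m n : ℕ} (I : Fin ℓ → Finset (Fin n))
    (a : Fin n → Fin m) (π : Fin ℓ → Fin m) : Fin n → Fin m :=
  fun i => if h : ∃ j, i ∈ I j then π h.choose else a i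

/-- The colouring `c` is constant on some uniform block set of degree `d` with
template `τ` (uniform: all blocks have the same size). -/
noncomputable def HasMonoUniformBlockSet {ℓ m n k : ℕ} (τ : Fin ℓ → Fin m) (d : ℕ)
    (c : (Fin n → Fin m) → Fin k) : Prop :=
  ∃ (I : Fin ℓ → Finset (Fin n)) (a : Fin n → Fin m),
    Pairwise (Function.onFun Disjoint I) ∧ (∑ j, (I j).card) = d ∧
    (∀ j j' : Fin ℓ, (I j).card = (I j').card) ∧
    ∃ col : Fin k, ∀ π : Fin ℓ → Fin m, IsRearrangement τ π →
      c (blockWord I a π) = col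

/-- Conjecture 6 of the paper (the Uniform statement): the Patterns statement with
uniform block sets. -/
noncomputable def UniformStatement : Prop :=
  ∀ (m k ℓ : ℕ) (τ : Fin ℓ → Fin m), ∃ n d : ℕ,
    ∀ c : (Fin n → Fin m) → Fin k, HasMonoUniformBlockSet τ d c

/-- A distance-preserving map between families of points is induced by a linear map on the
difference vectors. -/
theorem exists_linearMap_of_dist_eq {ι E F : Type*} [NormedAddCommGroup E] [InnerProductSpace ℝ E]
    [NormedAddCommGroup F] [InnerProductSpace ℝ F] [Nonempty ι] (p : ι → E) (q : ι → F)
    (h : ∀ a b, dist (q a) (q b) = dist (p a) (p b)) :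
    ∃ T : E →ₗ[ℝ] F, ∀ a b, q a - q b = T (p a - p b) := by
  obtain ⟨o⟩ := ‹Nonempty ι›
  let P := Finsupp.linearCombination ℝ (fun a => p a - p o)
  let Q := Finsupp.linearCombination ℝ (fun a => q a - q o)
  have hinner : ∀ a b, inner ℝ (q a - q o) (q b - q o) = inner ℝ (p a - p o) (p b - p o) := by
    intro a b
    simp only [real_inner_eq_norm_mul_self_add_norm_mul_self_sub_norm_sub_mul_self_div_two,
      sub_sub_sub_cancel_right, ← dist_eq_norm, h]
  have hPQ : ∀ t, inner ℝ (Q t) (Q t) = inner ℝ (P t) (P t) := by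
    intro t
    simp only [P, Q, Finsupp.linearCombination_apply, Finsupp.sum, sum_inner, inner_sum,
      inner_smul_left, inner_smul_right, hinner]
  have hker : ∀ t, P t = 0 → Q t = 0 := fun t ht => by
    rw [← inner_self_eq_zero (𝕜 := ℝ), hPQ, ht, inner_zero_left]
  obtain ⟨s, hs⟩ := P.rangeRestrict.exists_rightInverse_of_surjective P.range_rangeRestrict
  obtain ⟨T, hT⟩ := (Q.comp s).exists_extend
  have hTP : ∀ t, T (P t) = Q t := by
    intro t
    have h1 : T (P t) = Q (s (P.rangeRestrict t)) :=
      LinearMap.congr_fun hT (P.rangeRestrict t)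
    have h2 : P.rangeRestrict (s (P.rangeRestrict t)) = P.rangeRestrict t :=
      LinearMap.congr_fun hs (P.rangeRestrict t)
    rw [h1, ← sub_eq_zero, ← map_sub]
    apply hker
    rw [map_sub, sub_eq_zero]
    exact congrArg Subtype.val h2
  refine ⟨T, fun a b => ?_⟩
  have := hTP (Finsupp.single a 1 - Finsupp.single b 1)
  simpa [P, Q] using this.symm

theorem exists_perm_apply_eq {α : Type*} {n : ℕ} {s t : Fin n → α}
    (hs : Function.Injective s) (ht : Function.Injective t) :
    ∃ σ : Equiv.Perm α, ∀ i, σ (s i) = t i := by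
  obtain ⟨σ, hσ⟩ := (Equiv.Perm.isMultiplyPretransitive α n).exists_smul_eq ⟨s, hs⟩ ⟨t, ht⟩
  exact ⟨σ, fun i => DFunLike.congr_fun hσ i⟩

theorem exists_perm_apply_eq_pair {α : Type*} {i j a b : α} (hij : i ≠ j) (hab : a ≠ b) :
    ∃ σ : Equiv.Perm α, σ i = a ∧ σ j = b := by
  obtain ⟨σ, hσ⟩ := exists_perm_apply_eq (s := ![i, j]) (t := ![a, b])
    (by intro x y; fin_cases x <;> fin_cases y <;> simp [hij, hij.symm])
    (by intro x y; fin_cases x <;> fin_cases y <;> simp [hab, hab.symm])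
  exact ⟨σ, hσ 0, hσ 1⟩

/-- The numerical value `0, 2, 3, 4, …` of a letter; the gap makes the set of values asymmetric. -/
def letterValue {L : ℕ} (a : Fin L) : ℕ := if a.val = 0 then 0 else a.val + 1

theorem letterValue_injective {L : ℕ} : Function.Injective (letterValue (L := L)) := by
  intro a b h
  ext
  unfold letterValue at h
  split_ifs at h <;> omega

theorem letterValue_le {L : ℕ} (a : Fin L) : letterValue a ≤ L := by
  unfold letterValue
  split_ifs <;> omega

/-- The values of letters are not symmetric about any point. -/
theorem not_forall_letterValue_add_eq {ℓ : ℕ} (C : ℤ) :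
    ¬ ∀ a : Fin (ℓ + 4), ∃ b : Fin (ℓ + 4), (letterValue b : ℤ) + letterValue a = C := by
  intro h
  obtain ⟨b₀, h₀⟩ := h ⟨0, by omega⟩
  obtain ⟨b₁, h₁⟩ := h ⟨ℓ + 3, by omega⟩
  obtain ⟨b₂, h₂⟩ := h ⟨ℓ + 2, by omega⟩
  have := b₀.isLt
  have := b₁.isLt
  have := b₂.isLt
  unfold letterValue at h₀ h₁ h₂
  simp only at h₀ h₁ h₂
  split_ifs at h₀ h₁ h₂ <;> omega

theorem sum_mul_sub_swap {α : Type*} [Fintype α] [DecidableEq α] (v : α → ℝ) (u : α → ℝ)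
    (σ : Equiv.Perm α) {i j : α} (hij : i ≠ j) :
    ∑ x, v x * (u (σ x) - u ((σ * Equiv.swap i j) x)) = (v i - v j) * (u (σ i) - u (σ j)) := by
  rw [Fintype.sum_eq_add i j hij]
  · simp
    ring
  · rintro x ⟨hi, hj⟩
    simp [Equiv.swap_apply_of_ne_of_ne hi hj]

section Rigidity

variable {ℓ : ℕ} {v : Fin (ℓ + 4) → ℝ} {g : Equiv.Perm (Fin (ℓ + 4)) → Fin (ℓ + 4)}

theorem letterValue_sub_swap
    (h : ∀ σ ρ, (letterValue (g σ) : ℝ) - letterValue (g ρ) =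
      ∑ j, v j * ((letterValue (σ j) : ℝ) - letterValue (ρ j)))
    (σ : Equiv.Perm (Fin (ℓ + 4))) {i j : Fin (ℓ + 4)} (hij : i ≠ j) :
    (letterValue (g σ) : ℝ) - letterValue (g (σ * Equiv.swap i j)) =
      (v i - v j) * ((letterValue (σ i) : ℝ) - letterValue (σ j)) := by
  rw [h, ← sum_mul_sub_swap v (fun a => (letterValue a : ℝ)) σ hij]

theorem coefficient_sub_mem
    (h : ∀ σ ρ, (letterValue (g σ) : ℝ) - letterValue (g ρ) =
      ∑ j, v j * ((letterValue (σ j) : ℝ) - letterValue (ρ j)))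
    {i j : Fin (ℓ + 4)} (hij : i ≠ j) :
    v i - v j = 0 ∨ v i - v j = 1 ∨ v i - v j = -1 := by
  obtain ⟨σ, hi, hj⟩ := exists_perm_apply_eq_pair hij
    (a := (⟨2, by omega⟩ : Fin (ℓ + 4))) (b := ⟨1, by omega⟩) (by simp)
  obtain ⟨ρ, hi', hj'⟩ := exists_perm_apply_eq_pair hij
    (a := (⟨ℓ + 3, by omega⟩ : Fin (ℓ + 4))) (b := ⟨0, by omega⟩) (by simp)
  have h₁ := letterValue_sub_swap h σ hij
  have h₂ := letterValue_sub_swap h ρ hij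
  have hz : v i - v j = ((letterValue (g σ) - letterValue (g (σ * Equiv.swap i j)) : ℤ) : ℝ) := by
    push_cast
    rw [h₁, hi, hj]
    norm_num [letterValue]
  generalize ((letterValue (g σ) - letterValue (g (σ * Equiv.swap i j)) : ℤ)) = z at hz
  have ha := letterValue_le (g ρ)
  have hb := letterValue_le (g (ρ * Equiv.swap i j))
  generalize letterValue (g ρ) = a at *
  generalize letterValue (g (ρ * Equiv.swap i j)) = b at *
  have h₃ : (a : ℤ) - b = z * (ℓ + 4) := by
    rw [hz, hi', hj'] at h₂
    simp only [letterValue] at h₂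
    norm_num at h₂
    have h₂' : ((a - b : ℤ) : ℝ) = ((z * (ℓ + 4) : ℤ) : ℝ) := by
      push_cast
      linarith
    exact_mod_cast h₂'
  have hz1 : z ≤ 1 := by
    by_contra! hc
    nlinarith
  have hz2 : -1 ≤ z := by
    by_contra! hc
    nlinarith
  have : z = 0 ∨ z = 1 ∨ z = -1 := by omega
  rw [hz]
  rcases this with rfl | rfl | rfl <;> simp

theorem exists_coefficients_eq_off
    (h : ∀ σ ρ, (letterValue (g σ) : ℝ) - letterValue (g ρ) =
      ∑ j, v j * ((letterValue (σ j) : ℝ) - letterValue (ρ j))) :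
    ∃ j₀ w, ∀ j ≠ j₀, v j = w := by
  obtain ⟨o, ho⟩ := Finite.exists_min v
  have hv : ∀ j, v j = v o ∨ v j = v o + 1 := by
    intro j
    by_cases hj : j = o
    · exact Or.inl (by rw [hj])
    · rcases coefficient_sub_mem h hj with h' | h' | h'
      · left; linarith
      · right; linarith
      · linarith [ho j]
  let S := Finset.univ.filter fun j => v j = v o + 1
  let S' := Finset.univ.filter fun j => v j = v o
  by_cases hS : S.card ≤ 1
  · obtain ⟨j₀, hj₀⟩ := Finset.card_le_one_iff_subset_singleton.mp hS
    refine ⟨j₀, v o, fun j hj => (hv j).resolve_right fun hj' => hj ?_⟩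
    exact Finset.mem_singleton.mp (hj₀ (by simp [S, hj']))
  by_cases hS' : S'.card ≤ 1
  · obtain ⟨j₀, hj₀⟩ := Finset.card_le_one_iff_subset_singleton.mp hS'
    refine ⟨j₀, v o + 1, fun j hj => (hv j).resolve_left fun hj' => hj ?_⟩
    exact Finset.mem_singleton.mp (hj₀ (by simp [S', hj']))
  exfalso
  obtain ⟨i, hi, i', hi', hii⟩ := Finset.one_lt_card.mp (not_le.mp hS)
  obtain ⟨j, hj, j', hj', hjj⟩ := Finset.one_lt_card.mp (not_le.mp hS')
  simp only [S, S', Finset.mem_filter, Finset.mem_univ, true_and] at hi hi' hj hj'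
  have hne : ∀ {x y}, v x = v o + 1 → v y = v o → x ≠ y := by
    rintro x y hx hy rfl
    linarith
  obtain ⟨σ, hσ⟩ := exists_perm_apply_eq (s := ![i, j, i', j'])
    (t := ![(⟨ℓ + 3, by omega⟩ : Fin (ℓ + 4)), ⟨0, by omega⟩, ⟨2, by omega⟩, ⟨1, by omega⟩])
    (by
      intro x y
      fin_cases x <;> fin_cases y <;>
        simp [hii, hii.symm, hjj, hjj.symm, hne hi hj, (hne hi hj).symm, hne hi hj',
          (hne hi hj').symm, hne hi' hj, (hne hi' hj).symm, hne hi' hj', (hne hi' hj').symm])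
    (by intro x y; fin_cases x <;> fin_cases y <;> simp)
  have e₁ : σ i = ⟨ℓ + 3, by omega⟩ := hσ 0
  have e₂ : σ j = ⟨0, by omega⟩ := hσ 1
  have e₃ : σ i' = ⟨2, by omega⟩ := hσ 2
  have e₄ : σ j' = ⟨1, by omega⟩ := hσ 3
  have h₁ := letterValue_sub_swap h σ (hne hi hj)
  have h₂ := letterValue_sub_swap h (σ * Equiv.swap i j) (hne hi' hj')
  rw [Equiv.Perm.mul_apply, Equiv.Perm.mul_apply,
    Equiv.swap_apply_of_ne_of_ne hii.symm (hne hi' hj),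
    Equiv.swap_apply_of_ne_of_ne (hne hi hj').symm hjj.symm, e₃, e₄, hi', hj'] at h₂
  rw [e₁, e₂, hi, hj] at h₁
  have hle : (letterValue (g σ) : ℝ) ≤ ℓ + 4 := by exact_mod_cast letterValue_le (g σ)
  have hnn : (0 : ℝ) ≤ letterValue (g (σ * Equiv.swap i j * Equiv.swap i' j')) := by positivity
  generalize (letterValue (g σ) : ℝ) = a at *
  generalize (letterValue (g (σ * Equiv.swap i j)) : ℝ) = b at *
  generalize (letterValue (g (σ * Equiv.swap i j * Equiv.swap i' j')) : ℝ) = d at *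
  simp only [letterValue] at h₁ h₂
  norm_num at h₁ h₂
  linarith

/-- A letter-valued function of permutations that is affine in the values of the permutation
is a coordinate projection or constant. -/
theorem eq_apply_or_const
    (h : ∀ σ ρ, (letterValue (g σ) : ℝ) - letterValue (g ρ) =
      ∑ j, v j * ((letterValue (σ j) : ℝ) - letterValue (ρ j))) :
    (∃ j, ∀ σ, g σ = σ j) ∨ ∃ a, ∀ σ, g σ = a := by
  obtain ⟨j₀, w, hw⟩ := exists_coefficients_eq_off h
  obtain ⟨j₁, hj₁⟩ := exists_ne j₀
  have hdiff : ∀ σ ρ, (letterValue (g σ) : ℝ) - letterValue (g ρ) =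
      (v j₀ - w) * ((letterValue (σ j₀) : ℝ) - letterValue (ρ j₀)) := by
    intro σ ρ
    have hsum : ∑ j, w * ((letterValue (σ j) : ℝ) - letterValue (ρ j)) = 0 := by
      rw [← Finset.mul_sum, Finset.sum_sub_distrib,
        Equiv.sum_comp σ (fun j => (letterValue j : ℝ)),
        Equiv.sum_comp ρ (fun j => (letterValue j : ℝ)), sub_self, mul_zero]
    rw [h, ← sub_zero (∑ j, _), ← hsum, ← Finset.sum_sub_distrib, Fintype.sum_eq_single j₀]
    · ring
    · intro j hj
      rw [hw j hj, sub_self]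
  have hinj := letterValue_injective (L := ℓ + 4)
  have hsurj : ∀ a, ∃ σ : Equiv.Perm (Fin (ℓ + 4)), σ j₀ = a := fun a =>
    ⟨Equiv.swap j₀ a, Equiv.swap_apply_left _ _⟩
  have hμ := coefficient_sub_mem h hj₁.symm
  rw [hw j₁ hj₁] at hμ
  rcases hμ with hμ | hμ | hμ <;> rw [hμ] at hdiff
  · refine Or.inr ⟨g 1, fun σ => hinj ?_⟩
    have := hdiff σ 1
    rw [zero_mul, sub_eq_zero] at this
    exact_mod_cast this
  · refine Or.inl ⟨j₀, fun σ => hinj ?_⟩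
    obtain ⟨σ₀, h₀⟩ := hsurj ⟨0, by omega⟩
    obtain ⟨σ₁, h₁⟩ := hsurj ⟨ℓ + 3, by omega⟩
    have e₀ := hdiff σ σ₀
    have e₁ := hdiff σ σ₁
    have hle : (letterValue (g σ₁) : ℝ) ≤ ℓ + 4 := by exact_mod_cast letterValue_le (g σ₁)
    have hnn : (0 : ℝ) ≤ letterValue (g σ₀) := by positivity
    rw [h₀] at e₀
    rw [h₁] at e₁
    have t₀ : (letterValue (⟨0, by omega⟩ : Fin (ℓ + 4)) : ℝ) = 0 := by simp [letterValue]
    have t₁ : (letterValue (⟨ℓ + 3, by omega⟩ : Fin (ℓ + 4)) : ℝ) = ℓ + 4 := by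
      norm_num [letterValue, add_assoc]
    rw [t₀] at e₀
    rw [t₁] at e₁
    have : (letterValue (g σ) : ℝ) = letterValue (σ j₀) := by linarith
    exact_mod_cast this
  · refine (not_forall_letterValue_add_eq (ℓ := ℓ)
      (letterValue (g 1) + letterValue ((1 : Equiv.Perm (Fin (ℓ + 4))) j₀)) fun a => ?_).elim
    obtain ⟨σ, hσ⟩ := hsurj a
    refine ⟨g σ, ?_⟩
    have := hdiff σ 1
    rw [hσ] at this
    have h' : (letterValue (g σ) : ℝ) + letterValue a =
        letterValue (g 1) + letterValue ((1 : Equiv.Perm (Fin (ℓ + 4))) j₀) := by linarith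
    exact_mod_cast h'

end Rigidity

/-- The point of Euclidean space whose coordinates are the values of a permutation. -/
noncomputable def permPoint {L : ℕ} (σ : Equiv.Perm (Fin L)) : EuclideanSpace ℝ (Fin L) :=
  WithLp.toLp 2 fun j => (letterValue (σ j) : ℝ)

theorem isTransitiveSet_range_permPoint (L : ℕ) :
    IsTransitiveSet (Set.range (permPoint (L := L))) := by
  rintro _ ⟨σ, rfl⟩ _ ⟨ρ, rfl⟩
  let e := fun τ : Equiv.Perm (Fin L) => LinearIsometryEquiv.piLpCongrLeft 2 ℝ ℝ τ
  have he : ∀ τ π : Equiv.Perm (Fin L), e τ (permPoint π) = permPoint (π * τ⁻¹) := by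
    intro τ π
    ext j
    simp [e, permPoint, LinearIsometryEquiv.piLpCongrLeft_apply, Equiv.piCongrLeft'_apply]
  refine ⟨(e (ρ⁻¹ * σ)).toIsometryEquiv, ?_, ?_⟩
  · ext x
    constructor
    · rintro ⟨_, ⟨π, rfl⟩, rfl⟩
      exact ⟨_, (he _ π).symm⟩
    · rintro ⟨π, rfl⟩
      refine ⟨_, ⟨π * (ρ⁻¹ * σ), rfl⟩, ?_⟩
      exact (he _ _).trans (by rw [mul_inv_cancel_right])
  · exact (he _ _).trans (by group)

theorem IsRearrangement.exists_perm {ℓ m : ℕ} {τ π : Fin ℓ → Fin m} (h : IsRearrangement τ π) :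
    ∃ ρ : Equiv.Perm (Fin ℓ), ∀ j, τ (ρ j) = π j := by
  have e : ∀ a, Nonempty ({j // π j = a} ≃ {j // τ j = a}) := fun a =>
    ⟨Fintype.equivOfCardEq (by rw [Fintype.card_subtype, Fintype.card_subtype]; exact h a)⟩
  exact ⟨Equiv.ofFiberEquiv fun a => (e a).some, Equiv.ofFiberEquiv_map _⟩

theorem blockWord_of_mem {ℓ m n : ℕ} {I : Fin ℓ → Finset (Fin n)} {a : Fin n → Fin m}
    (hI : Pairwise (Function.onFun Disjoint I)) (π : Fin ℓ → Fin m) {i : Fin n} {j : Fin ℓ}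
    (hi : i ∈ I j) : blockWord I a π i = π j := by
  have h : ∃ j, i ∈ I j := ⟨j, hi⟩
  have : h.choose = j := by
    by_contra hne
    exact Finset.disjoint_left.mp (hI hne) h.choose_spec hi
  rw [blockWord, dif_pos h, this]

theorem blockWord_of_forall_notMem {ℓ m n : ℕ} {I : Fin ℓ → Finset (Fin n)} {a : Fin n → Fin m}
    (π : Fin ℓ → Fin m) {i : Fin n} (hi : ∀ j, i ∉ I j) : blockWord I a π i = a i :=
  dif_neg (by simpa using hi)

/-- The permutation of `Fin (ℓ + r)` acting as `ρ` on the first `ℓ` elements. -/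
def extendPerm {ℓ : ℕ} (r : ℕ) (ρ : Equiv.Perm (Fin ℓ)) : Equiv.Perm (Fin (ℓ + r)) :=
  finSumFinEquiv.permCongr (Equiv.sumCongr ρ (Equiv.refl (Fin r)))

theorem extendPerm_castAdd {ℓ r : ℕ} (ρ : Equiv.Perm (Fin ℓ)) (j : Fin ℓ) :
    extendPerm r ρ (Fin.castAdd r j) = Fin.castAdd r (ρ j) := by
  simp [extendPerm, Equiv.permCongr_apply]

theorem extendPerm_natAdd {ℓ r : ℕ} (ρ : Equiv.Perm (Fin ℓ)) (j : Fin r) :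
    extendPerm r ρ (Fin.natAdd ℓ j) = Fin.natAdd ℓ j := by
  simp [extendPerm, Equiv.permCongr_apply]

/-- Words indexed by permutations, each coordinate of which is a projection or constant, form a
block set; its blocks have size `d` if each symbol is projected to `d` times. -/
theorem hasMonoUniformBlockSet_of_projections {ℓ m N k d : ℕ} (τ : Fin ℓ → Fin m) (a₀ : Fin m)
    (c : (Fin N → Fin m) → Fin k) (g : Equiv.Perm (Fin (ℓ + 4)) → Fin N → Fin (ℓ + 4))
    (hg : ∀ i, (∃ j, ∀ σ, g σ i = σ j) ∨ ∃ a, ∀ σ, g σ i = a)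
    (J : Fin (ℓ + 4) → Finset (Fin N)) (hJ : ∀ i j, i ∈ J j ↔ ∀ σ, g σ i = σ j)
    (hd : ∀ j, (J j).card = d) (col : Fin k)
    (hc : ∀ σ, c (fun i => Fin.append τ (fun _ : Fin 4 => a₀) (g σ i)) = col) :
    HasMonoUniformBlockSet τ (ℓ * d) c := by
  have hdisj : Pairwise (Function.onFun Disjoint fun j : Fin ℓ => J (Fin.castAdd 4 j)) := by
    intro j j' hjj
    refine Finset.disjoint_left.mpr fun i hi hi' => hjj ?_
    have := ((hJ _ _).mp hi 1).symm.trans ((hJ _ _).mp hi' 1)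
    exact Fin.castAdd_injective ℓ 4 this
  refine ⟨fun j => J (Fin.castAdd 4 j), fun i => Fin.append τ (fun _ : Fin 4 => a₀) (g 1 i),
    hdisj, by simp [hd], fun j j' => by rw [hd, hd], col, fun π hπ => ?_⟩
  obtain ⟨ρ, hρ⟩ := hπ.exists_perm
  rw [← hc (extendPerm 4 ρ)]
  congr 1
  funext i
  by_cases hi : ∃ j : Fin ℓ, i ∈ J (Fin.castAdd 4 j)
  · obtain ⟨j, hj⟩ := hi
    rw [blockWord_of_mem hdisj π hj, (hJ _ _).mp hj, extendPerm_castAdd, Fin.append_left, hρ]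
  · push Not at hi
    rw [blockWord_of_forall_notMem π hi]
    congr 1
    rcases hg i with ⟨j, hj⟩ | ⟨a, ha⟩
    · induction j using Fin.addCases with
      | left j => exact absurd ((hJ _ _).mpr hj) (hi j)
      | right j => rw [hj, hj, extendPerm_natAdd, Equiv.Perm.one_apply]
    · rw [ha, ha]

theorem dist_permPoint_sq {L : ℕ} (σ ρ : Equiv.Perm (Fin L)) :
    dist (permPoint σ) (permPoint ρ) ^ 2 =
      ∑ j, ((letterValue (σ j) : ℝ) - letterValue (ρ j)) ^ 2 := by
  rw [EuclideanSpace.dist_eq, Real.sq_sqrt (by positivity)]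
  simp [permPoint, Real.dist_eq]

/-- In an isometric copy of the permutation points, scaled by `lam`, each symbol is projected to
`1 / lam ^ 2` times. -/
theorem card_projections {ℓ N : ℕ} {lam : ℝ} (hlam : 0 < lam)
    (q : Equiv.Perm (Fin (ℓ + 4)) → EuclideanSpace ℝ (Fin N))
    (hq : ∀ σ ρ, dist (q σ) (q ρ) = dist (permPoint σ) (permPoint ρ))
    (g : Equiv.Perm (Fin (ℓ + 4)) → Fin N → Fin (ℓ + 4))
    (hqg : ∀ σ i, q σ i = lam * letterValue (g σ i))
    (hg : ∀ i, (∃ j, ∀ σ, g σ i = σ j) ∨ ∃ a, ∀ σ, g σ i = a)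
    (J : Fin (ℓ + 4) → Finset (Fin N)) (hJ : ∀ i j, i ∈ J j ↔ ∀ σ, g σ i = σ j)
    (j : Fin (ℓ + 4)) : ((J j).card : ℝ) = 1 / lam ^ 2 := by
  have hpair : ∀ j j', j ≠ j' → lam ^ 2 * ((J j).card + (J j').card) = 2 := by
    intro j j' hjj
    have hne : (letterValue j : ℝ) - letterValue j' ≠ 0 := by
      rw [sub_ne_zero]
      exact_mod_cast letterValue_injective.ne hjj
    have key : ∀ i, (q 1 i - q (Equiv.swap j j') i) ^ 2 =
        lam ^ 2 * ((letterValue j : ℝ) - letterValue j') ^ 2 *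
          ((if i ∈ J j then 1 else 0) + (if i ∈ J j' then 1 else 0)) := by
      intro i
      rw [hqg, hqg]
      rcases hg i with ⟨x, hx⟩ | ⟨a, ha⟩
      · have hmem : ∀ y, i ∈ J y ↔ x = y := fun y => by
          rw [hJ]
          refine ⟨fun hy => ?_, fun hy => hy ▸ hx⟩
          simpa using (hx 1).symm.trans (hy 1)
        simp only [hmem, hx]
        by_cases h₁ : x = j
        · subst h₁
          simp [hjj]
          ring
        · by_cases h₂ : x = j'
          · subst h₂
            simp [hjj.symm]
            ring
          · simp [h₁, h₂, Equiv.swap_apply_of_ne_of_ne h₁ h₂]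
      · have hmem : ∀ y, i ∉ J y := fun y hy => by
          obtain ⟨z, hz⟩ := exists_ne y
          have h₁ := ((hJ i y).mp hy 1).symm.trans ((ha 1).trans (ha (Equiv.swap y z)).symm)
          rw [(hJ i y).mp hy] at h₁
          simp at h₁
          exact hz h₁.symm
        simp [hmem, ha]
    have hsq : dist (q 1) (q (Equiv.swap j j')) ^ 2 =
        dist (permPoint 1) (permPoint (Equiv.swap j j')) ^ 2 := by rw [hq]
    rw [dist_permPoint_sq, EuclideanSpace.dist_eq, Real.sq_sqrt (by positivity)] at hsq
    simp only [Real.dist_eq, sq_abs, key] at hsq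
    rw [← Finset.mul_sum, Finset.sum_add_distrib, Finset.sum_boole, Finset.sum_boole,
      Fintype.sum_eq_add j j' hjj] at hsq
    · simp only [Finset.filter_univ_mem, Equiv.Perm.one_apply, Equiv.swap_apply_left,
        Equiv.swap_apply_right] at hsq
      apply mul_right_cancel₀ (pow_ne_zero 2 hne)
      linarith
    · rintro x ⟨h₁, h₂⟩
      simp [Equiv.swap_apply_of_ne_of_ne h₁ h₂]
  obtain ⟨x, hx⟩ := exists_ne j
  obtain ⟨y, hy⟩ : ∃ y, y ∉ ({j, x} : Finset (Fin (ℓ + 4))) := by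
    by_contra! hall
    have h₁ := Finset.card_le_card (fun y _ => hall y : Finset.univ ⊆ _)
    have h₂ := Finset.card_le_two (a := j) (b := x)
    rw [Finset.card_univ, Fintype.card_fin] at h₁
    omega
  simp only [Finset.mem_insert, Finset.mem_singleton, not_or] at hy
  have h₁ := hpair j x hx.symm
  have h₂ := hpair j y (Ne.symm hy.1)
  have h₃ := hpair x y (Ne.symm hy.2)
  rw [eq_div_iff (by positivity)]
  linarith

/-- Proposition 2.4 of the paper: the Products statement implies the Uniform statement. -/
theorem products_implies_uniform : ProductsStatement → UniformStatement := by
  intro hP m k ℓ τ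
  rcases Nat.eq_zero_or_pos k with rfl | hk
  · exact ⟨0, 0, fun c => (c Fin.elim0).elim0⟩
  rcases Nat.eq_zero_or_pos ℓ with rfl | hℓ
  · refine ⟨0, 0, fun c => ⟨Fin.elim0, Fin.elim0, fun j => j.elim0, by simp, fun j => j.elim0,
      c Fin.elim0, fun π _ => congrArg c (Subsingleton.elim _ _)⟩⟩
  let a₀ := τ ⟨0, hℓ⟩
  obtain ⟨n, lam, hlam, hR⟩ := hP (ℓ + 4) (Set.range permPoint) (Set.finite_range _)
    (isTransitiveSet_range_permPoint _) k hk
  refine ⟨(ℓ + 4) * n, ℓ * ⌊1 / lam ^ 2⌋₊, fun c => ?_⟩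
  let val : Fin (ℓ + 4) → ℝ := fun b => lam * letterValue b
  have hval : Function.Injective val := fun a b hab =>
    letterValue_injective (by exact_mod_cast mul_left_cancel₀ hlam.ne' hab)
  obtain ⟨f, hf, hfY, col, hcol⟩ := hR fun y =>
    c fun i => Fin.append τ (fun _ : Fin 4 => a₀) (Function.invFun val (y.1 i))
  have hex : ∀ (σ : Equiv.Perm (Fin (ℓ + 4))) i, ∃ b : Fin (ℓ + 4), f (permPoint σ) i = lam * letterValue b := by
    intro σ i
    obtain ⟨p, ⟨x, hx, hpx⟩, hp⟩ := hfY _ ⟨σ, rfl⟩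
    obtain ⟨ρ, hρ⟩ := hx (finProdFinEquiv.symm i).2
    refine ⟨ρ (finProdFinEquiv.symm i).1, ?_⟩
    rw [← hp, PiLp.smul_apply, hpx, ← hρ]
    rfl
  choose g hg using hex
  have hdist : ∀ σ ρ, dist (f (permPoint σ)) (f (permPoint ρ)) =
      dist (permPoint σ) (permPoint ρ) := fun σ ρ => hf _ ⟨σ, rfl⟩ _ ⟨ρ, rfl⟩
  obtain ⟨T, hT⟩ := exists_linearMap_of_dist_eq permPoint (fun σ => f (permPoint σ)) hdist
  have hproj : ∀ i, (∃ j, ∀ σ, g σ i = σ j) ∨ ∃ a, ∀ σ, g σ i = a := by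
    intro i
    refine eq_apply_or_const (v := fun j => T (EuclideanSpace.single j 1) i / lam) fun σ ρ => ?_
    have h₁ : lam * ((letterValue (g σ i) : ℝ) - letterValue (g ρ i)) =
        T (permPoint σ - permPoint ρ) i := by
      rw [← hT, PiLp.sub_apply, hg, hg, mul_sub]
    have h₂ : permPoint σ - permPoint ρ = ∑ j, ((letterValue (σ j) : ℝ) - letterValue (ρ j)) •
        EuclideanSpace.single j (1 : ℝ) := by
      ext j
      simp [permPoint, Finset.sum_apply, Pi.single_apply]
    rw [h₂, map_sum, WithLp.ofLp_sum, Finset.sum_apply] at h₁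
    apply mul_left_cancel₀ hlam.ne'
    rw [h₁, Finset.mul_sum]
    refine Finset.sum_congr rfl fun j _ => ?_
    rw [map_smul, PiLp.smul_apply, smul_eq_mul]
    field_simp
  classical
  let J : Fin (ℓ + 4) → Finset (Fin ((ℓ + 4) * n)) := fun j =>
    Finset.univ.filter fun i => ∀ σ, g σ i = σ j
  have hJ : ∀ i j, i ∈ J j ↔ ∀ σ, g σ i = σ j := fun i j => by simp [J]
  refine hasMonoUniformBlockSet_of_projections τ a₀ c g hproj J hJ (fun j => ?_) col fun σ => ?_
  · rw [← card_projections hlam _ hdist g hg hproj J hJ j, Nat.floor_natCast]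
  · rw [← hcol _ ⟨σ, rfl⟩]
    congr 1
    funext i
    rw [hg]
    exact congrArg _ (Function.leftInverse_invFun hval (g σ i)).symm
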